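/- arXiv:1104.4593 — 2 statements merged into one kernel-verified Lean document; each statement's English description precedes it below -/
import Mathlib

section
/- Permutations of [n] whose left-to-right-maxima decomposition m_1 L_1 ... m_r L_r satisfies L_1 < L_2 < ... < L_r (every entry of L_i less than every entry of L_j for i < j) are in bijection with cycle-labeled ordered trees on n edges. -/
/-- A cycle-labeled ordered tree: each vertex carries a list of labeled child
subtrees (each child edge carries a natural-number label). -/
inductive CTree where
  | node : List (ℕ × CTree) → CTree

/-- Number of edges of a cycle-labeled ordered tree. -/
def CTree.edges : CTree → ℕ
  | .node cs => cs.length + (cs.attach.map (fun c => CTree.edges c.1.2)).sum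
  decreasing_by
    obtain ⟨⟨l, t⟩, hm⟩ := c
    have := List.sizeOf_lt_of_mem hm
    simp at this ⊢; omega

/-- Validity of a cycle-labeling: at each non-leaf vertex with `d` children the
child-edge labels, read left to right, form a permutation of `{1,…,d}` whose
first entry is `d` (a standard cycle). -/
def CTree.valid : CTree → Prop
  | .node cs =>
      (cs ≠ [] → (cs.map Prod.fst).head? = some cs.length ∧
        (cs.map Prod.fst).Perm (List.range' 1 cs.length)) ∧
      ∀ c ∈ cs.attach, CTree.valid c.1.2
  decreasing_by
    obtain ⟨⟨l, t⟩, hm⟩ := c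
    have := List.sizeOf_lt_of_mem hm
    simp at this ⊢; omega

/-- Position `j` is a left-to-right maximum of `π`. -/
def IsLRMax {n : ℕ} (π : Equiv.Perm (Fin n)) (j : Fin n) : Prop :=
  ∀ i : Fin n, i < j → π i < π j

namespace CTree

theorem edges_node (cs : List (ℕ × CTree)) :
    (node cs).edges = cs.length + ((cs.map Prod.snd).map edges).sum := by
  rw [edges, List.map_map, List.attach_map_val (f := fun c : ℕ × CTree => c.2.edges)]
  rfl

theorem valid_node (cs : List (ℕ × CTree)) :
    (node cs).valid ↔
      (cs ≠ [] → (cs.map Prod.fst).head? = some cs.length ∧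
        (cs.map Prod.fst).Perm (List.range' 1 cs.length)) ∧
      ∀ t ∈ cs.map Prod.snd, t.valid := by
  rw [valid]
  refine and_congr_right fun _ => ⟨fun h t ht => ?_, fun h c _ => ?_⟩
  · obtain ⟨c, hc, rfl⟩ := List.mem_map.1 ht
    exact h ⟨c, hc⟩ (List.mem_attach _ _)
  · exact h _ (List.mem_map_of_mem c.2)

end CTree

/-- Lists rearranging `1, …, e`. -/
abbrev LabelList (e : ℕ) := {σ : List ℕ // σ.Perm (List.range' 1 e)}

/-- Lists of `k` cycle-labeled trees with `N + 1 - k` edges in total. -/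
abbrev LabeledForest (N k : ℕ) :=
  {f : List CTree // (∀ t ∈ f, t.valid) ∧ f.length = k ∧ (f.map CTree.edges).sum + k = N + 1}

/-- `Separated u t`: every entry of `u` which is not a left-to-right maximum is less than
every entry of `t`, and less than every entry of `u` separated from it by a left-to-right maximum. -/
def Separated (u t : List ℕ) : Prop :=
  ∀ (i p : ℕ) (hp : p < u.length) (hip : i < p), u[p] < u[i] →
    (∀ y ∈ t, u[p] < y) ∧
      ∀ (m q : ℕ) (hq : q < u.length) (_ : p < m) (hmq : m < q),
        (∀ (a : ℕ) (ha : a < m), u[a] < u[m]) → u[p] < u[q]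

/-- Permutations of `0, …, N - 1` split into a word `u` and an increasing word `t` of
length `k - 1` for which `Separated u t` holds. -/
abbrev SeparatedWord (N k : ℕ) :=
  {w : List ℕ × List ℕ // (w.1 ++ w.2).Perm (List.range N) ∧ w.2.length + 1 = k ∧
    w.2.Pairwise (· < ·) ∧ Separated w.1 w.2}

theorem separated_append_cons {u L t : List ℕ} {M : ℕ} (hu : ∀ x ∈ u, x < M)
    (hL : ∀ x ∈ L, x < M) :
    Separated (u ++ M :: L) t ↔ Separated u (L ++ t) ∧ ∀ x ∈ L, ∀ y ∈ t, x < y := by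
  have hlen : (u ++ M :: L).length = u.length + 1 + L.length := by simp; omega
  have eu : ∀ (i : ℕ) (h : i < u.length), (u ++ M :: L)[i]'(by omega) = u[i] :=
    fun i h => List.getElem_append_left h
  have eM : (u ++ M :: L)[u.length]'(by omega) = M := by simp
  have eL : ∀ (q : ℕ) (h : q < L.length), (u ++ M :: L)[u.length + 1 + q]'(by omega) = L[q] := by
    intro q h
    simp [List.getElem_append_right, add_assoc, Nat.add_comm 1]
  have hle : ∀ (i : ℕ) (h : i < (u ++ M :: L).length), (u ++ M :: L)[i] ≤ M := by
    intro i h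
    have := List.getElem_mem h
    generalize (u ++ M :: L)[i] = x at this
    simp only [List.mem_append, List.mem_cons] at this
    rcases this with h | h | h
    · exact (hu x h).le
    · exact h.le
    · exact (hL x h).le
  have hnot : ∀ (m : ℕ) (h : m < (u ++ M :: L).length),
      (∀ (a : ℕ) (ha : a < m), (u ++ M :: L)[a] < (u ++ M :: L)[m]) → m ≤ u.length := by
    intro m h hm
    by_contra! hlt
    have := hm u.length hlt
    have := hle m h
    omega
  constructor
  · intro h
    refine ⟨fun i p hp hip hlt => ?_, fun x hx y hy => ?_⟩
    · have h0 := h i p (by omega) hip (by rwa [eu, eu])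
      rw [eu p hp] at h0
      refine ⟨fun y hy => ?_, fun m q hq hpm hmq hm => ?_⟩
      · rcases List.mem_append.1 hy with hy | hy
        · obtain ⟨q, hq, rfl⟩ := List.getElem_of_mem hy
          rw [← eL q hq]
          refine h0.2 u.length (u.length + 1 + q) (by omega) hp (by omega) fun a ha => ?_
          rw [eM, eu a ha]
          exact hu _ (List.getElem_mem _)
        · exact h0.1 y hy
      · rw [← eu q hq]
        refine h0.2 m q (by omega) hpm hmq fun a ha => ?_
        rw [eu a (by omega), eu m (by omega)]
        exact hm a ha
    · obtain ⟨q, hq, rfl⟩ := List.getElem_of_mem hx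
      rw [← eL q hq]
      refine (h u.length (u.length + 1 + q) (by omega) (by omega) ?_).1 y hy
      rw [eL q hq, eM]
      exact hL _ (List.getElem_mem _)
  · rintro ⟨h, hLt⟩ i p hp hip hlt
    have hcase : p < u.length ∨ p = u.length ∨ ∃ r, r < L.length ∧ p = u.length + 1 + r := by
      by_cases hpu : p ≤ u.length
      · omega
      · exact .inr (.inr ⟨p - (u.length + 1), by omega, by omega⟩)
    rcases hcase with hpu | rfl | ⟨r, hr, rfl⟩
    · rw [eu p hpu, eu i (by omega)] at hlt
      rw [eu p hpu]
      have h0 := h i p hpu hip hlt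
      refine ⟨fun y hy => h0.1 y (List.mem_append_right _ hy), fun m q hq hpm hmq hm => ?_⟩
      have hmu := hnot m (by omega) hm
      by_cases hqu : q < u.length
      · rw [eu q hqu]
        refine h0.2 m q hqu hpm hmq fun a ha => ?_
        rw [← eu a (by omega), ← eu m (by omega)]
        exact hm a ha
      · by_cases hqM : q = u.length
        · subst hqM
          rw [eM]
          exact hu _ (List.getElem_mem _)
        · obtain ⟨r, rfl⟩ : ∃ r, q = u.length + 1 + r := ⟨q - (u.length + 1), by omega⟩
          rw [eL r (by omega)]
          exact h0.1 _ (List.mem_append_left _ (List.getElem_mem _))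
    · have := hle i (by omega)
      omega
    · refine ⟨fun y hy => ?_, fun m q hq hpm hmq hm => ?_⟩
      · rw [eL r hr]
        exact hLt _ (List.getElem_mem _) y hy
      · have := hnot m (by omega) hm
        omega

theorem separated_append_singleton {u t : List ℕ} {M : ℕ} (hu : ∀ x ∈ u, x < M) :
    Separated u (t ++ [M]) ↔ Separated u t := by
  unfold Separated
  grind

/-- Prepend a leaf to a forest, or join the first `e + 1` trees of a forest under a new root. -/
def graft {N k : ℕ} :
    LabeledForest N k ⊕ (Σ e, LabelList e × LabeledForest N (k + 1 + e)) →
      LabeledForest (N + 1) (k + 1)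
  | .inl f => ⟨.node [] :: f.1, by
      obtain ⟨f, hv, hl, hs⟩ := f
      simp [CTree.valid_node, CTree.edges_node]
      exact ⟨hv, hl, by omega⟩⟩
  | .inr ⟨e, σ, f⟩ => ⟨.node (((e + 1) :: σ.1).zip (f.1.take (e + 1))) :: f.1.drop (e + 1), by
      obtain ⟨f, hv, hl, hs⟩ := f
      obtain ⟨σ, hσ⟩ := σ
      have hσl : σ.length = e := by simpa using hσ.length_eq
      have h1 : (((e + 1) :: σ).zip (f.take (e + 1))).map Prod.fst = (e + 1) :: σ :=
        List.map_fst_zip (by simp; omega)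
      have h2 : (((e + 1) :: σ).zip (f.take (e + 1))).map Prod.snd = f.take (e + 1) :=
        List.map_snd_zip (by simp; omega)
      have h3 : (((e + 1) :: σ).zip (f.take (e + 1))).length = e + 1 := by
        simp; omega
      have h4 : ((f.take (e + 1)).map CTree.edges).sum + ((f.drop (e + 1)).map CTree.edges).sum
          = (f.map CTree.edges).sum := by
        rw [← List.sum_append, ← List.map_append, List.take_append_drop]
      refine ⟨?_, by simp; omega, ?_⟩
      · intro t ht
        rcases List.mem_cons.1 ht with rfl | ht
        · rw [CTree.valid_node, h1, h2, h3]
          refine ⟨fun _ => ⟨rfl, ?_⟩, fun t ht => hv t (List.mem_of_mem_take ht)⟩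
          rw [List.range'_1_concat]
          exact (hσ.cons _).trans (by rw [add_comm 1 e]; exact (List.perm_append_singleton _ _).symm)
        · exact hv t (List.mem_of_mem_drop ht)
      · simp only [List.map_cons, List.sum_cons]
        rw [CTree.edges_node, h2, h3]
        omega⟩

theorem graft_bijective {N k : ℕ} : Function.Bijective (@graft N k) := by
  constructor
  · rintro (⟨f, hv, hl, hs⟩ | ⟨e, ⟨σ, hσ⟩, ⟨f, hv, hl, hs⟩⟩)
      (⟨f', hv', hl', hs'⟩ | ⟨e', ⟨σ', hσ'⟩, ⟨f', hv', hl', hs'⟩⟩) h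
    · simpa [graft] using h
    · have := congrArg (fun x => x.1.head?) h
      cases f' <;> simp [graft] at this hl'
      omega
    · have := congrArg (fun x => x.1.head?) h
      cases f <;> simp [graft] at this hl
      omega
    · simp only [graft, Subtype.mk.injEq, List.cons.injEq, CTree.node.injEq] at h
      obtain ⟨hz, hd⟩ := h
      have hσl : σ.length = e := by simpa using hσ.length_eq
      have hσl' : σ'.length = e' := by simpa using hσ'.length_eq
      have h1 := congrArg (List.map Prod.fst) hz
      have h2 := congrArg (List.map Prod.snd) hz
      rw [List.map_fst_zip (by simp; omega), List.map_fst_zip (by simp; omega)] at h1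
      rw [List.map_snd_zip (by simp; omega), List.map_snd_zip (by simp; omega)] at h2
      simp only [List.cons.injEq, Nat.add_right_cancel_iff] at h1
      obtain ⟨rfl, rfl⟩ := h1
      have : f = f' := by
        rw [← List.take_append_drop (e + 1) f, h2, hd, List.take_append_drop]
      subst this
      rfl
  · rintro ⟨f, hv, hl, hs⟩
    match f, hv, hl, hs with
    | .node [] :: f, hv, hl, hs =>
      refine ⟨.inl ⟨f, fun t ht => hv t (by simp [ht]), by simpa using hl, ?_⟩, rfl⟩
      simp [CTree.edges_node] at hs
      omega
    | .node (c :: cs) :: f, hv, hl, hs =>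
      have hroot := (CTree.valid_node _).1 (hv _ (List.mem_cons_self ..))
      obtain ⟨hhead, hperm⟩ := hroot.1 (by simp)
      simp only [List.map_cons, List.head?_cons, Option.some.injEq, List.length_cons] at hhead hperm
      rw [List.range'_1_concat, hhead, add_comm 1] at hperm
      have hσ := (List.perm_cons _).1 (hperm.trans (List.perm_append_singleton _ _))
      simp only [List.length_cons] at hl
      refine ⟨.inr ⟨cs.length, ⟨cs.map Prod.fst, hσ⟩,
        ⟨(c :: cs).map Prod.snd ++ f, ?_, ?_, ?_⟩⟩, ?_⟩
      · intro t ht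
        rcases List.mem_append.1 ht with ht | ht
        · exact hroot.2 t ht
        · exact hv t (by simp [ht])
      · simp
        omega
      · rw [List.map_cons, List.sum_cons, CTree.edges_node, List.length_cons] at hs
        rw [List.map_append, List.sum_append]
        omega
      · have ht : ((c :: cs).map Prod.snd ++ f).take (cs.length + 1) = (c :: cs).map Prod.snd :=
          List.take_left' (by simp)
        have hd : ((c :: cs).map Prod.snd ++ f).drop (cs.length + 1) = f :=
          List.drop_left' (by simp)
        have hc : (cs.length + 1) :: cs.map Prod.fst = (c :: cs).map Prod.fst := by simp [hhead]
        have hz : ((c :: cs).map Prod.fst).zip ((c :: cs).map Prod.snd) = c :: cs :=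
          (List.zip_of_prod rfl rfl).symm
        simp only [graft, ht, hd, hc, hz]

/-- The list of entries of `t` at the (one-based) places listed by `σ`. -/
def pick (t σ : List ℕ) : List ℕ := σ.map fun i => t.getD (i - 1) 0

theorem pick_range' (t : List ℕ) {e : ℕ} (he : e ≤ t.length) :
    pick t (List.range' 1 e) = t.take e := by
  apply List.ext_getElem
  · simp [pick, he]
  · intro i h1 h2
    simp [pick] at h1 h2 ⊢
    grind

theorem pick_perm {t σ : List ℕ} {e : ℕ} (he : e ≤ t.length) (hσ : σ.Perm (List.range' 1 e)) :
    (pick t σ).Perm (t.take e) :=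
  pick_range' t he ▸ hσ.map _

theorem pick_injective {t σ τ : List ℕ} {e : ℕ} (he : e ≤ t.length) (ht : t.Nodup)
    (hσ : σ.Perm (List.range' 1 e)) (hτ : τ.Perm (List.range' 1 e))
    (h : pick t σ = pick t τ) : σ = τ := by
  have hlen : σ.length = τ.length := hσ.length_eq.trans hτ.length_eq.symm
  apply List.ext_getElem hlen
  intro i h1 h2
  have ha := hσ.mem_iff.1 (List.getElem_mem h1)
  have hb := hτ.mem_iff.1 (List.getElem_mem h2)
  have hi := congrArg (fun l => l[i]?) h
  simp only [List.mem_range'_1] at ha hb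
  simp only [pick, List.getElem?_map, List.getElem?_eq_getElem h1, List.getElem?_eq_getElem h2,
    Option.map_some, Option.some.injEq] at hi
  rw [List.getD_eq_getElem _ _ (by omega), List.getD_eq_getElem _ _ (by omega),
    ht.getElem_inj_iff] at hi
  omega

theorem exists_pick_eq {t L : List ℕ} {e : ℕ} (he : e ≤ t.length) (ht : t.Nodup)
    (hL : L.Perm (t.take e)) : ∃ σ : List ℕ, σ.Perm (List.range' 1 e) ∧ pick t σ = L := by
  refine ⟨L.map fun x => t.idxOf x + 1, (hL.map _).trans (List.Perm.of_eq ?_), ?_⟩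
  · apply List.ext_getElem
    · simp [he]
    · intro i h1 h2
      simp [ht.idxOf_getElem, add_comm]
  · rw [pick, List.map_map]
    refine (List.map_congr_left fun x hx => ?_).trans (List.map_id _)
    have hx : x ∈ t := List.mem_of_mem_take (hL.mem_iff.1 hx)
    simp [List.getElem?_eq_getElem (List.idxOf_lt_length_of_mem hx)]

theorem SeparatedWord.lt {N k : ℕ} (w : SeparatedWord N k) {x : ℕ} (hx : x ∈ w.1.1 ++ w.1.2) :
    x < N :=
  List.mem_range.1 (w.2.1.mem_iff.1 hx)

/-- Insert the new largest entry `N`, either at the end of the increasing word, or at the end of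
the first word, followed by a rearrangement of the `e` smallest entries of the increasing word. -/
def insertTop {N k : ℕ} :
    SeparatedWord N k ⊕ (Σ e, LabelList e × SeparatedWord N (k + 1 + e)) →
      SeparatedWord (N + 1) (k + 1)
  | .inl w => ⟨(w.1.1, w.1.2 ++ [N]), by
      have hlt := @w.lt
      obtain ⟨⟨u, t⟩, hp, hl, hs, hw⟩ := w
      dsimp only at *
      refine ⟨?_, by simpa using hl, ?_, (separated_append_singleton fun x hx => ?_).2 hw⟩
      · rw [List.range_succ, ← List.append_assoc]
        exact hp.append_right _
      · rw [List.pairwise_append]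
        exact ⟨hs, by simp, fun x hx y hy => by
          rw [List.mem_singleton.1 hy]; exact hlt (by simp [hx])⟩
      · exact hlt (by simp [hx])⟩
  | .inr ⟨e, σ, w⟩ => ⟨(w.1.1 ++ N :: pick w.1.2 σ.1, w.1.2.drop e), by
      have hlt := @w.lt
      obtain ⟨⟨u, t⟩, hp, hl, hs, hw⟩ := w
      obtain ⟨σ, hσ⟩ := σ
      dsimp only at *
      have htl : t.length + 1 = k + 1 + e := hl
      have hpick := pick_perm (t := t) (by omega) hσ
      have hs' := hs
      rw [← List.take_append_drop e t, List.pairwise_append] at hs'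
      refine ⟨?_, by simp; omega, hs'.2.1, (separated_append_cons ?_ ?_).2 ⟨?_, ?_⟩⟩
      · rw [List.range_succ]
        refine List.Perm.trans ?_ (hp.append_right _)
        refine List.Perm.trans ?_ (List.perm_append_singleton _ _).symm
        rw [List.append_assoc, List.cons_append]
        refine List.perm_middle.trans (List.Perm.cons _ (List.Perm.append_left _ ?_))
        exact (hpick.append_right _).trans (by rw [List.take_append_drop])
      · exact fun x hx => hlt (by simp [hx])
      · exact fun x hx => hlt (List.mem_append_right _ (List.mem_of_mem_take (hpick.mem_iff.1 hx)))
      · intro i p hp hip hlt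
        refine ⟨fun y hy => (hw i p hp hip hlt).1 y ?_, (hw i p hp hip hlt).2⟩
        rcases List.mem_append.1 hy with hy | hy
        · exact List.mem_of_mem_take (hpick.mem_iff.1 hy)
        · exact List.mem_of_mem_drop hy
      · exact fun x hx y hy => hs'.2.2 x (hpick.mem_iff.1 hx) y hy⟩

theorem append_cons_inj_of_notMem_left {α : Type*} {a : α} {u v L K : List α} (hu : a ∉ u)
    (hv : a ∉ v) (h : u ++ a :: L = v ++ a :: K) : u = v ∧ L = K := by
  induction u generalizing v with
  | nil => cases v <;> simp_all
  | cons x u ih =>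
    cases v with
    | nil => exact absurd (List.cons.inj h).1.symm (List.ne_of_not_mem_cons hu)
    | cons y v =>
      simp only [List.cons_append, List.cons.injEq, List.mem_cons, not_or] at h hu hv
      obtain ⟨rfl, rfl⟩ := ih hu.2 hv.2 h.2
      exact ⟨congrArg (· :: u) h.1, rfl⟩

theorem insertTop_injective {N k : ℕ} : Function.Injective (@insertTop N k) := by
  rintro (w | ⟨e, ⟨σ, hσ⟩, w⟩) (w' | ⟨e', ⟨σ', hσ'⟩, w'⟩) h
  · simp only [insertTop, Subtype.mk.injEq, Prod.mk.injEq, List.append_cancel_right_eq] at h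
    exact congrArg _ (Subtype.ext (Prod.ext h.1 h.2))
  · simp only [insertTop, Subtype.mk.injEq, Prod.mk.injEq] at h
    have hN : N ∈ w.1.1 := by rw [h.1]; simp
    exact absurd (w.lt (List.mem_append_left _ hN)) (lt_irrefl _)
  · simp only [insertTop, Subtype.mk.injEq, Prod.mk.injEq] at h
    have hN : N ∈ w'.1.1 := by rw [← h.1]; simp
    exact absurd (w'.lt (List.mem_append_left _ hN)) (lt_irrefl _)
  · simp only [insertTop, Subtype.mk.injEq, Prod.mk.injEq] at h
    have hlt := @w.lt
    have hlt' := @w'.lt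
    obtain ⟨⟨u, t⟩, hp, hl, hs, hw⟩ := w
    obtain ⟨⟨u', t'⟩, hp', hl', hs', hw'⟩ := w'
    dsimp only at *
    have htl : t.length + 1 = k + 1 + e := hl
    have htl' : t'.length + 1 = k + 1 + e' := hl'
    obtain ⟨h1, hd⟩ := h
    have hN : N ∉ u := fun hx => lt_irrefl _ (hlt (List.mem_append_left _ hx))
    have hN' : N ∉ u' := fun hx => lt_irrefl _ (hlt' (List.mem_append_left _ hx))
    have hpick := pick_perm (t := t) (by omega) hσ
    have hpick' := pick_perm (t := t') (by omega) hσ'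
    obtain ⟨rfl, hL⟩ := append_cons_inj_of_notMem_left hN hN' h1
    have he : e = e' := by
      have h2 := congrArg List.length hL
      simp only [hpick.length_eq, hpick'.length_eq, List.length_take] at h2
      omega
    subst he
    have htake : t.take e = t'.take e :=
      List.Perm.eq_of_pairwise (fun a b _ _ h h' => absurd h (lt_asymm h'))
        (hs.sublist (List.take_sublist _ _)) (hs'.sublist (List.take_sublist _ _))
        (hpick.symm.trans (hL ▸ hpick'))
    have ht : t = t' := by
      rw [← List.take_append_drop e t, htake, hd, List.take_append_drop]
    subst ht
    obtain rfl := pick_injective (by omega) (hs.imp ne_of_lt) hσ hσ' hL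
    rfl

theorem insertTop_surjective {N k : ℕ} : Function.Surjective (@insertTop N k) := by
  rintro ⟨⟨u, t⟩, hp, hl, hs, hw⟩
  have hnd : (u ++ t).Nodup := hp.nodup_iff.2 List.nodup_range
  have hle : ∀ x ∈ u ++ t, x ≤ N := fun x hx =>
    Nat.lt_succ_iff.1 (List.mem_range.1 (hp.mem_iff.1 hx))
  have hN : N ∈ u ++ t := hp.mem_iff.2 (by simp)
  rw [List.range_succ] at hp
  rcases List.mem_append.1 hN with hN | hN
  · obtain ⟨v, L, rfl⟩ := List.append_of_mem hN
    rw [List.append_assoc, List.cons_append, List.nodup_middle, List.nodup_cons] at hnd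
    have hlt : ∀ x ∈ v ++ (L ++ t), x < N := fun x hx =>
      lt_of_le_of_ne (hle x (by simp only [List.mem_append, List.mem_cons] at hx ⊢; tauto))
        (ne_of_mem_of_not_mem hx hnd.1)
    have hv : ∀ x ∈ v, x < N := fun x hx => hlt x (by simp [hx])
    have hL : ∀ x ∈ L, x < N := fun x hx => hlt x (by simp [hx])
    obtain ⟨hsep, hLt⟩ := (separated_append_cons hv hL).1 hw
    have hLnd : L.Nodup := hnd.2.of_append_right.of_append_left
    have hsort := List.mergeSort_perm L (· ≤ ·)
    set s := L.mergeSort (· ≤ ·)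
    have hslt : s.Pairwise (· < ·) := by
      have h1 : s.Pairwise (· ≤ ·) := List.pairwise_mergeSort' (· ≤ ·) L
      have h2 : s.Nodup := hsort.nodup_iff.2 hLnd
      exact h1.imp₂ (fun _ _ h h' => lt_of_le_of_ne h h') h2
    have htake : (s ++ t).take L.length = s := List.take_left' hsort.length_eq
    have hdrop : (s ++ t).drop L.length = t := List.drop_left' hsort.length_eq
    have hst : (s ++ t).Pairwise (· < ·) :=
      List.pairwise_append.2 ⟨hslt, hs, fun x hx y hy => hLt x (hsort.mem_iff.1 hx) y hy⟩
    obtain ⟨σ, hσ, hpick⟩ := exists_pick_eq (t := s ++ t) (L := L) (e := L.length)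
      (by simp [hsort.length_eq]) (hst.imp ne_of_lt) (by rw [htake]; exact hsort.symm)
    refine ⟨.inr ⟨L.length, ⟨σ, hσ⟩, ⟨(v, s ++ t), ?_, ?_, hst, ?_⟩⟩, ?_⟩
    · rw [List.append_assoc, List.cons_append] at hp
      have := (List.perm_cons _).1
        ((List.perm_middle.symm.trans hp).trans (List.perm_append_singleton _ _))
      exact ((hsort.append_right t).append_left v).trans this
    · have htl : t.length + 1 = k + 1 := hl
      simp [hsort.length_eq]
      omega
    · intro i p hp hip hlt
      refine ⟨fun y hy => (hsep i p hp hip hlt).1 y ?_, (hsep i p hp hip hlt).2⟩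
      simpa [hsort.mem_iff] using hy
    · simp only [insertTop, hpick, hdrop]
  · obtain ⟨t', b, rfl⟩ := List.append_of_mem hN
    have hb : b = [] := by
      rw [List.eq_nil_iff_forall_not_mem]
      intro x hx
      have h1 := (List.pairwise_cons.1 (List.pairwise_append.1 hs).2.1).1 x hx
      have h2 := hle x (by simp [hx])
      omega
    subst hb
    have hu : ∀ x ∈ u, x < N := fun x hx =>
      lt_of_le_of_ne (hle x (by simp [hx])) fun h =>
        List.disjoint_of_nodup_append hnd hx (by simp [h])
    refine ⟨.inl ⟨(u, t'), ?_, by simpa using hl, (List.pairwise_append.1 hs).1,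
      (separated_append_singleton hu).1 hw⟩, rfl⟩
    rw [← List.append_assoc] at hp
    exact (List.perm_append_right_iff _).1 hp

theorem nonempty_labeledForest_equiv_separatedWord (N k : ℕ) :
    Nonempty (LabeledForest N k ≃ SeparatedWord N k) := by
  induction N generalizing k with
  | zero =>
    by_cases hk : k = 1
    · subst hk
      have hF (f : LabeledForest 0 1) : f.1 = [.node []] := by
        obtain ⟨f, -, hl, hs⟩ := f
        obtain ⟨⟨cs⟩, rfl⟩ := List.length_eq_one_iff.1 hl
        simp [CTree.edges_node] at hs
        simp [hs.1]
      have hW (w : SeparatedWord 0 1) : w.1 = ([], []) := by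
        obtain ⟨⟨u, t⟩, hp, -⟩ := w
        simpa using hp
      refine ⟨⟨fun _ => ⟨([], []), by simp [Separated]⟩,
        fun _ => ⟨[.node []], by simp [CTree.valid_node, CTree.edges_node]⟩,
        fun f => Subtype.ext (hF f).symm, fun w => Subtype.ext (hW w).symm⟩⟩
    · have : IsEmpty (LabeledForest 0 k) := ⟨fun ⟨f, _, hl, hs⟩ => by
        have : k = 0 := by omega
        subst this
        simp [List.length_eq_zero_iff.1 hl] at hs⟩
      have : IsEmpty (SeparatedWord 0 k) := ⟨fun ⟨⟨u, t⟩, hp, hl, _⟩ => by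
        simp at hp
        simp [hp.2] at hl
        omega⟩
      exact ⟨Equiv.equivOfIsEmpty _ _⟩
  | succ N ih =>
    cases k with
    | zero =>
      have : IsEmpty (LabeledForest (N + 1) 0) := ⟨fun ⟨f, _, hl, hs⟩ => by
        simp [List.length_eq_zero_iff.1 hl] at hs⟩
      have : IsEmpty (SeparatedWord (N + 1) 0) := ⟨fun ⟨⟨u, t⟩, hp, hl, _⟩ => by simp at hl⟩
      exact ⟨Equiv.equivOfIsEmpty _ _⟩
    | succ k =>
      refine ⟨(Equiv.ofBijective _ graft_bijective).symm.trans (Equiv.trans ?_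
        (Equiv.ofBijective _ ⟨insertTop_injective, insertTop_surjective⟩))⟩
      exact Equiv.sumCongr (ih k).some
        (Equiv.sigmaCongrRight fun e => Equiv.prodCongr (Equiv.refl _) (ih _).some)

theorem nonempty_tree_equiv_labeledForest (n : ℕ) :
    Nonempty ({t : CTree // t.valid ∧ t.edges = n} ≃ LabeledForest n 1) := by
  refine ⟨Equiv.ofBijective (fun t => ⟨[t.1], by simpa using t.2⟩) ⟨fun t t' h => ?_, ?_⟩⟩
  · simpa [Subtype.ext_iff] using h
  · rintro ⟨f, hv, hl, hs⟩
    obtain ⟨t, rfl⟩ := List.length_eq_one_iff.1 hl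
    exact ⟨⟨t, by simpa using hv, by simpa using hs⟩, rfl⟩

theorem separated_ofFn_iff {n : ℕ} (π : Equiv.Perm (Fin n)) :
    Separated (List.ofFn fun i => (π i : ℕ)) [] ↔
      ∀ p q : Fin n, ¬ IsLRMax π p → ¬ IsLRMax π q →
        (∃ m : Fin n, IsLRMax π m ∧ p < m ∧ m < q) → π p < π q := by
  constructor
  · rintro h p q hp - ⟨m, hm, hpm, hmq⟩
    simp only [IsLRMax, not_forall, not_lt] at hp
    obtain ⟨i, hip, hle⟩ := hp
    have hlt : π p < π i := lt_of_le_of_ne hle fun h => hip.ne' (π.injective h)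
    have := (h i p (by simp) hip (by simpa using hlt)).2 m q (by simp) hpm hmq
      (fun a ha => by simpa using hm ⟨a, by omega⟩ ha)
    simpa using this
  · intro h i p hp hip hlt
    refine ⟨by simp, fun m q hq hpm hmq hm => ?_⟩
    simp only [List.length_ofFn] at hp hq
    simp only [List.getElem_ofFn, Fin.val_fin_lt] at hlt hm ⊢
    have hm' : IsLRMax π ⟨m, by omega⟩ := fun a ha => hm a ha
    by_cases hqm : IsLRMax π ⟨q, hq⟩
    · exact hqm ⟨p, hp⟩ (hpm.trans hmq)
    · refine h ⟨p, hp⟩ ⟨q, hq⟩ (fun hpm' => ?_) hqm ⟨_, hm', hpm, hmq⟩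
      exact lt_asymm hlt (hpm' ⟨i, by omega⟩ hip)

theorem perm_range_ofFn {n : ℕ} (π : Equiv.Perm (Fin n)) :
    (List.ofFn fun i => (π i : ℕ)).Perm (List.range n) := by
  refine (List.perm_ext_iff_of_nodup
    (List.nodup_ofFn.2 (Fin.val_injective.comp π.injective)) List.nodup_range).2 fun a => ?_
  simp only [List.mem_ofFn, List.mem_range]
  exact ⟨fun ⟨i, hi⟩ => hi ▸ (π i).2, fun ha => ⟨π.symm ⟨a, ha⟩, by simp⟩⟩

theorem exists_ofFn_eq_of_perm_range {n : ℕ} {u : List ℕ} (hu : u.Perm (List.range n)) :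
    ∃ π : Equiv.Perm (Fin n), (List.ofFn fun i => (π i : ℕ)) = u := by
  have hlen : u.length = n := by simpa using hu.length_eq
  have hnd : u.Nodup := hu.nodup_iff.2 List.nodup_range
  let f : Fin n → Fin n := fun i =>
    ⟨u[i], List.mem_range.1 (hu.mem_iff.1 (List.getElem_mem _))⟩
  have hf : Function.Injective f := fun i j h => by
    simpa [f, hnd.getElem_inj_iff, Fin.val_inj] using h
  refine ⟨Equiv.ofBijective f (Finite.injective_iff_bijective.1 hf), ?_⟩
  apply List.ext_getElem
  · simp [hlen]
  · simp [f]

theorem nonempty_perm_equiv_separatedWord (n : ℕ) :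
    Nonempty ({π : Equiv.Perm (Fin n) //
      ∀ p q : Fin n, ¬ IsLRMax π p → ¬ IsLRMax π q →
        (∃ m : Fin n, IsLRMax π m ∧ p < m ∧ m < q) → π p < π q} ≃ SeparatedWord n 1) := by
  refine ⟨Equiv.ofBijective (fun π => ⟨(List.ofFn fun i => (π.1 i : ℕ), []),
    by simpa using perm_range_ofFn π.1, rfl, List.Pairwise.nil, (separated_ofFn_iff π.1).2 π.2⟩)
    ⟨fun π π' h => ?_, ?_⟩⟩
  · simp only [Subtype.mk.injEq, Prod.mk.injEq, and_true] at h
    have := List.ofFn_injective h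
    exact Subtype.ext (Equiv.ext fun i => Fin.ext (congrFun this i))
  · rintro ⟨⟨u, t⟩, hp, hl, -, hw⟩
    obtain rfl : t = [] := by simpa using hl
    obtain ⟨π, rfl⟩ := exists_ofFn_eq_of_perm_range (by simpa using hp)
    exact ⟨⟨π, (separated_ofFn_iff π).1 hw⟩, rfl⟩

/-- Permutations of `[n]` whose LR-maxima decomposition satisfies
`L₁ < L₂ < ⋯ < L_r` entrywise are in bijection with cycle-labeled ordered
trees on `n` edges. -/
theorem perms_equiv_cycleLabeledTrees (n : ℕ) :
    Nonempty
      ({π : Equiv.Perm (Fin n) //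
          ∀ p q : Fin n, ¬ IsLRMax π p → ¬ IsLRMax π q →
            (∃ m : Fin n, IsLRMax π m ∧ p < m ∧ m < q) → π p < π q} ≃
        {t : CTree // t.valid ∧ t.edges = n}) :=
  ⟨((nonempty_perm_equiv_separatedWord n).some.trans
    (nonempty_labeledForest_equiv_separatedWord n 1).some.symm).trans
    (nonempty_tree_equiv_labeledForest n).some.symm⟩
end

section
/- Let a_n denote the number of 3-bar5-241-avoiding permutations of [n-1] (with a_1 = 1 counting the empty permutation). Then for all n ≥ 1, a_{n+1} = (1/(n+1)) Σ_{partitions 1^{r_1}···n^{r_n} of n} multinomial(n+1; n+1-Σr_i, r_1, ..., r_n) · a_1^{r_1} a_2^{r_2} ··· a_n^{r_n}. -/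
/-- The Lagrange-inversion partition sum
`∑ multinomial(n+1; n+1-∑rᵢ, r₁,…,rₙ) a₁^{r₁} ⋯ aₙ^{rₙ}` over all
`r₁,…,rₙ ≥ 0` with `∑ i·rᵢ = n` (each `rᵢ ≤ n` automatically). -/
noncomputable def pSum (n : ℕ) (a : ℕ → ℚ) : ℚ :=
  ∑ r ∈ Finset.univ.filter
      (fun r : Fin n → Fin (n + 1) => ∑ i, (i.1 + 1) * (r i).1 = n),
    ((Nat.factorial (n + 1) : ℚ) /
        ((Nat.factorial (n + 1 - ∑ i, (r i).1) : ℚ) * ∏ i, (Nat.factorial (r i).1 : ℚ))) *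
      ∏ i, a (i.1 + 1) ^ (r i).1

/-- `π` avoids the barred pattern 3̄5241: every occurrence of the classical
pattern 3241 extends to an occurrence of 35241. -/
def AvoidsBarred {n : ℕ} (π : Equiv.Perm (Fin n)) : Prop :=
  ∀ i j k l : Fin n, i < j → j < k → k < l →
    π l < π j → π j < π i → π i < π k →
    ∃ m : Fin n, i < m ∧ m < j ∧ π k < π m

/-- A word over `ℕ` avoids the barred pattern 3̄5241. -/
def AvoidsBarredWord (w : List ℕ) : Prop :=
  ∀ i j k l : ℕ, i < j → j < k → k < l → l < w.length →
    w.getD l 0 < w.getD j 0 → w.getD j 0 < w.getD i 0 → w.getD i 0 < w.getD k 0 →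
    ∃ m, i < m ∧ m < j ∧ w.getD k 0 < w.getD m 0

/-- Every entry of `w` that is not a left-to-right maximum is smaller than `x`. -/
def NonRecordsBelow (w : List ℕ) (x : ℕ) : Prop :=
  w.Pairwise fun a b => b < a → b < x

theorem avoidsBarredWord_append_cons {σ τ : List ℕ} {N : ℕ} (hσ : ∀ y ∈ σ, y < N)
    (hτ : ∀ y ∈ τ, y < N) (hdisj : ∀ y ∈ τ, y ∉ σ) :
    AvoidsBarredWord (σ ++ N :: τ) ↔
      AvoidsBarredWord σ ∧ AvoidsBarredWord τ ∧ ∀ y ∈ τ, NonRecordsBelow σ y := by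
  have hleft : ∀ i < σ.length, (σ ++ N :: τ).getD i 0 = σ.getD i 0 := fun i hi =>
    List.getD_append _ _ _ _ hi
  have hmid : (σ ++ N :: τ).getD σ.length 0 = N := by simp
  have hright : ∀ i, (σ ++ N :: τ).getD (σ.length + 1 + i) 0 = τ.getD i 0 := fun i => by
    rw [List.getD_append_right _ _ _ _ (by omega),
      show σ.length + 1 + i - σ.length = i + 1 by omega, List.getD_cons_succ]
  have hlen : (σ ++ N :: τ).length = σ.length + 1 + τ.length := by
    simp only [List.length_append, List.length_cons]; omega
  have hσmem : ∀ i < σ.length, σ.getD i 0 ∈ σ := fun i hi => by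
    rw [List.getD_eq_getElem _ _ hi]; exact List.getElem_mem hi
  have hτmem : ∀ i < τ.length, τ.getD i 0 ∈ τ := fun i hi => by
    rw [List.getD_eq_getElem _ _ hi]; exact List.getElem_mem hi
  have hle : ∀ i, i < σ.length + 1 + τ.length → (σ ++ N :: τ).getD i 0 ≤ N := by
    intro i hi
    rcases lt_trichotomy i σ.length with h | h | h
    · rw [hleft i h]; exact (hσ _ (hσmem i h)).le
    · rw [h, hmid]
    · obtain ⟨p, rfl⟩ := Nat.exists_eq_add_of_le (Nat.succ_le_of_lt h)
      rw [Nat.succ_eq_add_one, hright p]; exact (hτ _ (hτmem p (by omega))).le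
  constructor
  · intro h
    refine ⟨?_, ?_, ?_⟩
    · intro i j k l hij hjk hkl hl h1 h2 h3
      have := h i j k l hij hjk hkl (by omega)
      rw [hleft i (by omega), hleft j (by omega), hleft k (by omega), hleft l (by omega)] at this
      obtain ⟨m, hm1, hm2, hm3⟩ := this h1 h2 h3
      rw [hleft m (by omega)] at hm3
      exact ⟨m, hm1, hm2, hm3⟩
    · intro i j k l hij hjk hkl hl h1 h2 h3
      have := h (σ.length + 1 + i) (σ.length + 1 + j) (σ.length + 1 + k) (σ.length + 1 + l)
        (by omega) (by omega) (by omega) (by omega)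
      simp only [hright] at this
      obtain ⟨m, hm1, hm2, hm3⟩ := this h1 h2 h3
      obtain ⟨p, rfl⟩ := Nat.exists_eq_add_of_le (show σ.length + 1 ≤ m by omega)
      rw [hright] at hm3
      exact ⟨p, by omega, by omega, hm3⟩
    · intro y hy
      obtain ⟨p, hp, rfl⟩ := List.getElem_of_mem hy
      refine List.pairwise_iff_getElem.2 fun i j hi hj hij hlt => ?_
      by_contra hge
      have hne : τ[p] ≠ σ[j] := fun e => hdisj _ hy (e ▸ List.getElem_mem hj)
      have := h i j σ.length (σ.length + 1 + p) hij hj (by omega) (by omega)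
      rw [hright, hmid, hleft i hi, hleft j hj, List.getD_eq_getElem _ _ hi,
        List.getD_eq_getElem _ _ hj, List.getD_eq_getElem _ _ hp] at this
      obtain ⟨m, -, hm2, hm3⟩ := this (by omega) hlt (hσ _ (List.getElem_mem hi))
      have := hle m (by omega)
      omega
  · rintro ⟨h1, h2, h3⟩ i j k l hij hjk hkl hl hlj hji hik
    have hlN := hle l (by omega)
    have hkN := hle k (by omega)
    rcases lt_trichotomy l σ.length with hl' | rfl | hl'
    · rw [hleft i (by omega), hleft j (by omega), hleft k (by omega)] at *
      rw [hleft l (by omega)] at *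
      obtain ⟨m, hm1, hm2, hm3⟩ := h1 i j k l hij hjk hkl hl' hlj hji hik
      exact ⟨m, hm1, hm2, by rwa [hleft m (by omega)]⟩
    · rw [hmid] at hlj; omega
    · obtain ⟨q, rfl⟩ := Nat.exists_eq_add_of_le (Nat.succ_le_of_lt hl')
      rw [Nat.succ_eq_add_one] at *
      rw [hright] at hlj
      rcases lt_trichotomy j σ.length with hj | rfl | hj
      · rw [hleft j hj] at hlj hji
        rw [hleft i (by omega)] at hji
        have hq : q < τ.length := by omega
        have := List.pairwise_iff_getElem.1 (h3 _ (hτmem q hq)) i j (by omega) hj hij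
        rw [List.getD_eq_getElem _ _ hj] at hlj hji
        rw [List.getD_eq_getElem _ _ (show i < σ.length by omega)] at hji
        have := this hji
        omega
      · omega
      · obtain ⟨b, rfl⟩ := Nat.exists_eq_add_of_le (Nat.succ_le_of_lt hj)
        obtain ⟨c, rfl⟩ := Nat.exists_eq_add_of_le (show σ.length + 1 ≤ k by omega)
        rw [Nat.succ_eq_add_one] at *
        rcases lt_trichotomy i σ.length with hi | rfl | hi
        · refine ⟨σ.length, hi, by omega, ?_⟩
          rw [hmid, hright]
          exact hτ _ (hτmem c (by omega))
        · omega
        · obtain ⟨a, rfl⟩ := Nat.exists_eq_add_of_le (Nat.succ_le_of_lt hi)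
          rw [Nat.succ_eq_add_one] at *
          simp only [hright] at hlj hji hik
          obtain ⟨m, hm1, hm2, hm3⟩ := h2 a b c q (by omega) (by omega) (by omega) (by omega)
            hlj hji hik
          exact ⟨σ.length + 1 + m, by omega, by omega, by rw [hright, hright]; exact hm3⟩

theorem nonRecordsBelow_append_cons {σ τ : List ℕ} {N x : ℕ} (hσ : ∀ y ∈ σ, y < N)
    (hτ : ∀ y ∈ τ, y < N) :
    NonRecordsBelow (σ ++ N :: τ) x ↔ NonRecordsBelow σ x ∧ ∀ y ∈ τ, y < x := by
  simp only [NonRecordsBelow, List.pairwise_append, List.pairwise_cons, List.mem_cons]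
  constructor
  · rintro ⟨h1, ⟨h2, -⟩, -⟩
    exact ⟨h1, fun y hy => h2 y hy (hτ y hy)⟩
  · rintro ⟨h1, h2⟩
    refine ⟨h1, ⟨fun y hy _ => h2 y hy, ?_⟩, ?_⟩
    · exact List.Pairwise.imp_of_mem (R := fun _ _ => True)
        (fun _ hb _ _ => h2 _ hb) (List.pairwise_of_forall (fun _ _ => trivial))
    · rintro a ha b (rfl | hb) hlt
      · exact absurd hlt (hσ a ha).not_gt
      · exact h2 b hb

open Classical in
/-- The arrangements of `V` that avoid 3̄5241 and whose entries other than left-to-right maxima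
are smaller than every element of `X`. -/
noncomputable def avoidersBelow (V X : Finset ℕ) : Finset (List ℕ) :=
  V.val.lists.toFinset.filter fun w => AvoidsBarredWord w ∧ ∀ x ∈ X, NonRecordsBelow w x

theorem mem_avoidersBelow {V X : Finset ℕ} {w : List ℕ} :
    w ∈ avoidersBelow V X ↔ (w.Nodup ∧ ∀ y, y ∈ w ↔ y ∈ V) ∧ AvoidsBarredWord w ∧
      ∀ x ∈ X, NonRecordsBelow w x := by
  classical
  rw [avoidersBelow, Finset.mem_filter, Multiset.mem_toFinset, Multiset.mem_lists_iff]
  refine and_congr_left fun _ => ?_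
  change V.val = (w : Multiset ℕ) ↔ _
  constructor
  · intro h
    have hnd := V.nodup
    rw [h] at hnd
    exact ⟨Multiset.coe_nodup.1 hnd, fun y => by rw [← Finset.mem_val, h, Multiset.mem_coe]⟩
  · rintro ⟨h1, h2⟩
    exact (Multiset.Nodup.ext V.nodup (Multiset.coe_nodup.2 h1)).2 fun y => by simp [h2]

theorem card_avoidersBelow {V X : Finset ℕ} {N : ℕ} (hN : N ∈ V) (hmax : ∀ y ∈ V, y ≤ N) :
    (avoidersBelow V X).card =
      ∑ Y ∈ (V.erase N).powerset with ∀ x ∈ X, ∀ y ∈ Y, y < x,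
        (avoidersBelow (V.erase N \ Y) (X ∪ Y)).card * (avoidersBelow Y ∅).card := by
  simp only [← Finset.card_product]
  rw [← Finset.card_sigma]
  symm
  refine Finset.card_bij (fun p _ => p.2.1 ++ N :: p.2.2) ?_ ?_ ?_
  · rintro ⟨Y, σ, τ⟩ h
    simp only [Finset.mem_sigma, Finset.mem_filter, Finset.mem_powerset, Finset.mem_product,
      mem_avoidersBelow, Finset.mem_union, Finset.mem_sdiff, Finset.mem_erase] at h ⊢
    obtain ⟨⟨hYV, hYX⟩, ⟨⟨hσ, hσm⟩, hσa, hσX⟩, ⟨hτ, hτm⟩, hτa, -⟩ := h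
    have hY : ∀ y ∈ Y, y ≠ N ∧ y ∈ V := fun y hy => Finset.mem_erase.1 (hYV hy)
    have hσN : ∀ y ∈ σ, y < N := fun y hy =>
      have := (hσm y).1 hy
      lt_of_le_of_ne (hmax y this.1.2) this.1.1
    have hτN : ∀ y ∈ τ, y < N := fun y hy =>
      have := hY y ((hτm y).1 hy)
      lt_of_le_of_ne (hmax y this.2) this.1
    have hd : ∀ y ∈ τ, y ∉ σ := fun y hy hy' => ((hσm y).1 hy').2 ((hτm y).1 hy)
    rw [avoidsBarredWord_append_cons hσN hτN hd]
    refine ⟨⟨?_, ?_⟩, ⟨hσa, hτa, fun y hy => hσX y (Or.inr ((hτm y).1 hy))⟩, fun x hx => ?_⟩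
    · refine List.nodup_append'.2 ⟨hσ, List.nodup_cons.2 ⟨fun h => (hτN N h).false, hτ⟩, ?_⟩
      intro y hy hy'
      rcases List.mem_cons.1 hy' with rfl | hy'
      · exact (hσN _ hy).false
      · exact hd y hy' hy
    · intro y
      simp only [List.mem_append, List.mem_cons, hσm, hτm]
      constructor
      · rintro (h | rfl | h)
        exacts [h.1.2, hN, (hY y h).2]
      · intro h
        by_cases h1 : y = N <;> by_cases h2 : y ∈ Y <;> simp [h, h1, h2]
    · rw [nonRecordsBelow_append_cons hσN hτN]
      exact ⟨hσX x (Or.inl hx), fun y hy => hYX x hx y ((hτm y).1 hy)⟩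
  · rintro ⟨Y, σ, τ⟩ h ⟨Y', σ', τ'⟩ h' heq
    simp only [Finset.mem_sigma, Finset.mem_filter, Finset.mem_powerset, Finset.mem_product,
      mem_avoidersBelow, Finset.mem_sdiff, Finset.mem_erase] at h h' heq
    have e1 : N ∉ σ := fun hm => ((h.2.1.1.2 N).1 hm).1.1 rfl
    have e2 : N ∉ σ' := fun hm => ((h'.2.1.1.2 N).1 hm).1.1 rfl
    have e3 : N ∉ τ := fun hm => (Finset.mem_erase.1 (h.1.1 ((h.2.2.1.2 N).1 hm))).1 rfl
    have e4 : N ∉ τ' := fun hm => (Finset.mem_erase.1 (h'.1.1 ((h'.2.2.1.2 N).1 hm))).1 rfl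
    obtain ⟨rfl, -, rfl⟩ := (List.append_cons_inj_of_notMem e2 e4).1 heq.symm
    have : Y = Y' := by
      ext y
      rw [← h.2.2.1.2 y, ← h'.2.2.1.2 y]
    subst this
    rfl
  · intro w hw
    rw [mem_avoidersBelow] at hw
    obtain ⟨⟨hnd, hm⟩, ha, hX⟩ := hw
    obtain ⟨σ, τ, rfl⟩ := List.append_of_mem ((hm N).2 hN)
    obtain ⟨hσ, hNτ, hd⟩ := List.nodup_append'.1 hnd
    obtain ⟨hNτ', hτ⟩ := List.nodup_cons.1 hNτ
    have hNσ : N ∉ σ := fun h => hd h (by simp)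
    have hd' : ∀ y ∈ τ, y ∉ σ := fun y h h' => hd h' (by simp [h])
    have hσN : ∀ y ∈ σ, y < N := fun y hy =>
      lt_of_le_of_ne (hmax y ((hm y).1 (by simp [hy]))) (fun h => hNσ (h ▸ hy))
    have hτN : ∀ y ∈ τ, y < N := fun y hy =>
      lt_of_le_of_ne (hmax y ((hm y).1 (by simp [hy]))) (fun h => hNτ' (h ▸ hy))
    rw [avoidsBarredWord_append_cons hσN hτN hd'] at ha
    simp only [nonRecordsBelow_append_cons hσN hτN] at hX
    refine ⟨⟨τ.toFinset, σ, τ⟩, ?_, rfl⟩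
    simp only [Finset.mem_sigma, Finset.mem_filter, Finset.mem_powerset, Finset.mem_product,
      mem_avoidersBelow, Finset.mem_union, Finset.mem_sdiff, Finset.mem_erase, List.mem_toFinset]
    refine ⟨⟨fun y hy => ?_, fun x hx y hy => (hX x hx).2 y hy⟩, ⟨⟨hσ, fun y => ?_⟩, ha.1, ?_⟩,
      ⟨hτ, by simp⟩, ha.2.1, by simp⟩
    · rw [List.mem_toFinset] at hy
      exact Finset.mem_erase.2 ⟨(hτN y hy).ne, (hm y).1 (by simp [hy])⟩
    · constructor
      · intro hy
        exact ⟨⟨(hσN y hy).ne, (hm y).1 (by simp [hy])⟩, fun h => hd' y h hy⟩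
      · rintro ⟨⟨h1, h2⟩, h3⟩
        have := (hm y).2 h2
        simpa [h1, h3] using this
    · rintro x (hx | hx)
      · exact (hX x hx).1
      · exact ha.2.2 x hx

/-- The solution of the recurrence satisfied by the numbers of 3̄5241-avoiding permutations of
length `n` with `l` marks inserted among the values above every non-record. -/
def markedCount : ℕ → ℕ → ℕ
  | 0, _ => 1
  | n + 1, l => ∑ j : Fin (n + 1), ∑ s ∈ Finset.range (l + 1),
      markedCount j 0 * markedCount (n - j) (j + s)
termination_by n => n

theorem markedCount_zero_left (l : ℕ) : markedCount 0 l = 1 := by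
  rw [markedCount]

theorem markedCount_succ_zero (n : ℕ) :
    markedCount (n + 1) 0 =
      ∑ j ∈ Finset.range (n + 1), markedCount j 0 * markedCount (n - j) j := by
  rw [markedCount, Finset.sum_range]
  simp

theorem markedCount_succ_succ (n l : ℕ) :
    markedCount (n + 1) (l + 1) = markedCount (n + 1) l +
      ∑ j ∈ Finset.range (n + 1), markedCount j 0 * markedCount (n - j) (j + (l + 1)) := by
  rw [markedCount, markedCount, Finset.sum_range]
  simp only [Finset.sum_range_succ _ (l + 1), Finset.sum_add_distrib]

theorem Finset.exists_subset_card_eq_forall_lt (Z : Finset ℕ) (l : ℕ) (hl : l ≤ Z.card) :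
    ∃ X ⊆ Z, X.card = l ∧ ∀ x ∈ X, ∀ y ∈ Z \ X, y < x := by
  induction l with
  | zero => exact ⟨∅, by simp⟩
  | succ l ih =>
    obtain ⟨X, hXZ, hX, hlt⟩ := ih (by omega)
    have hne : (Z \ X).Nonempty := by
      rw [← Finset.card_pos, Finset.card_sdiff_of_subset hXZ]; omega
    have hmem := (Z \ X).max'_mem hne
    have hmem' := Finset.mem_sdiff.1 hmem
    refine ⟨insert ((Z \ X).max' hne) X, Finset.insert_subset hmem'.1 hXZ, ?_, ?_⟩
    · rw [Finset.card_insert_of_notMem hmem'.2, hX]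
    · intro x hx y hy
      simp only [Finset.mem_sdiff, Finset.mem_insert, not_or] at hy
      have hy' : y ∈ Z \ X := Finset.mem_sdiff.2 ⟨hy.1, hy.2.2⟩
      rcases Finset.mem_insert.1 hx with rfl | hx
      · exact lt_of_le_of_ne ((Z \ X).le_max' y hy') hy.2.1
      · exact hlt x hx y hy'

theorem Finset.eq_of_union_eq_of_forall_lt {X Y X' Y' : Finset ℕ} (h : X ∪ Y = X' ∪ Y')
    (hc : X.card = X'.card) (hlt : ∀ x ∈ X, ∀ y ∈ Y, y < x) (hlt' : ∀ x ∈ X', ∀ y ∈ Y', y < x) :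
    X = X' := by
  by_cases hs : X ⊆ X'
  · exact Finset.eq_of_subset_of_card_le hs hc.ge
  · obtain ⟨x, hx, hx'⟩ := Finset.not_subset.1 hs
    refine (Finset.eq_of_subset_of_card_le (fun x' hx'' => ?_) hc.le).symm
    by_contra hn
    have h1 : x ∈ Y' := by
      have : x ∈ X' ∪ Y' := h ▸ Finset.mem_union_left Y hx
      simpa [hx'] using this
    have h2 : x' ∈ Y := by
      have : x' ∈ X ∪ Y := h.symm ▸ Finset.mem_union_left Y' hx''
      simpa [hn] using this
    exact lt_asymm (hlt x hx x' h2) (hlt' x' hx'' x h1)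

/-- Splitting a set into its `l` largest elements and the rest is a bijection. -/
theorem Finset.sum_powersetCard_sum_lt (W : Finset ℕ) (n l : ℕ) (hW : W.card = n + l)
    (F : Finset ℕ → ℕ) (G : ℕ → ℕ) :
    ∑ X ∈ W.powersetCard l, ∑ Y ∈ (W \ X).powerset with ∀ x ∈ X, ∀ y ∈ Y, y < x,
        F (X ∪ Y) * G Y.card =
      ∑ j ∈ Finset.range (n + 1), G j * ∑ Z ∈ W.powersetCard (j + l), F Z := by
  simp only [Finset.mul_sum]
  rw [Finset.sum_sigma', Finset.sum_sigma']
  have hcard : ∀ X Y : Finset ℕ, Y ⊆ W \ X → (X ∪ Y).card = Y.card + X.card := fun X Y h => by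
    rw [Finset.card_union_of_disjoint, add_comm]
    exact (Finset.disjoint_sdiff.mono_right h)
  refine Finset.sum_bij (fun p _ => ⟨p.2.card, p.1 ∪ p.2⟩) ?_ ?_ ?_ ?_
  · rintro ⟨X, Y⟩ h
    simp only [Finset.mem_sigma, Finset.mem_powersetCard, Finset.mem_filter,
      Finset.mem_powerset, Finset.mem_range] at h ⊢
    obtain ⟨⟨hX, hXl⟩, hY, -⟩ := h
    have hsub : X ∪ Y ⊆ W := Finset.union_subset hX (hY.trans Finset.sdiff_subset)
    have := Finset.card_le_card hsub
    have := hcard X Y hY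
    exact ⟨by omega, hsub, by omega⟩
  · rintro ⟨X, Y⟩ h ⟨X', Y'⟩ h' heq
    simp only [Finset.mem_sigma, Finset.mem_powersetCard, Finset.mem_filter,
      Finset.mem_powerset, Sigma.mk.injEq, heq_eq_eq] at h h' heq
    obtain ⟨⟨hX, hXl⟩, hY, hlt⟩ := h
    obtain ⟨⟨hX', hXl'⟩, hY', hlt'⟩ := h'
    obtain rfl := Finset.eq_of_union_eq_of_forall_lt heq.2 (hXl.trans hXl'.symm) hlt hlt'
    have hd : Disjoint X Y := Finset.disjoint_sdiff.mono_right hY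
    have hd' : Disjoint X Y' := Finset.disjoint_sdiff.mono_right hY'
    have : Y = Y' := by
      rw [← Finset.union_sdiff_cancel_left hd, heq.2, Finset.union_sdiff_cancel_left hd']
    rw [this]
  · rintro ⟨j, Z⟩ h
    simp only [Finset.mem_sigma, Finset.mem_powersetCard, Finset.mem_range] at h
    obtain ⟨-, hZ, hZc⟩ := h
    obtain ⟨X, hXZ, hX, hlt⟩ := Finset.exists_subset_card_eq_forall_lt Z l (by omega)
    refine ⟨⟨X, Z \ X⟩, ?_, ?_⟩
    · simp only [Finset.mem_sigma, Finset.mem_powersetCard, Finset.mem_filter, Finset.mem_powerset]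
      exact ⟨⟨hXZ.trans hZ, hX⟩, Finset.sdiff_subset_sdiff hZ le_rfl, hlt⟩
    · simp only [Finset.union_sdiff_of_subset hXZ, Finset.card_sdiff_of_subset hXZ, hX, hZc,
        Nat.add_sub_cancel]
  · rintro ⟨X, Y⟩ _
    exact mul_comm _ _

theorem avoidersBelow_insert_max {V X : Finset ℕ} {N : ℕ} (hV : ∀ y ∈ V, y < N) :
    avoidersBelow V (insert N X) = avoidersBelow V X := by
  ext w
  simp only [mem_avoidersBelow, Finset.forall_mem_insert]
  refine and_congr_right fun hw => and_congr_right fun _ => and_iff_right ?_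
  exact List.Pairwise.imp_of_mem (R := fun _ _ => True)
    (fun _ hb _ _ => hV _ ((hw.2 _).1 hb)) (List.pairwise_of_forall (fun _ _ => trivial))

theorem avoidersBelow_empty_left (X : Finset ℕ) : avoidersBelow ∅ X = {[]} := by
  ext w
  rw [mem_avoidersBelow, Finset.mem_singleton]
  constructor
  · rintro ⟨⟨-, h⟩, -⟩
    exact List.eq_nil_iff_forall_not_mem.2 fun y hy => by simpa using (h y).1 hy
  · rintro rfl
    refine ⟨by simp, fun i j k l _ _ _ hl => by simp at hl, fun x _ => List.Pairwise.nil⟩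

theorem sum_card_avoidersBelow (n l : ℕ) (W : Finset ℕ) (hW : W.card = n + l) :
    ∑ X ∈ W.powersetCard l, (avoidersBelow (W \ X) X).card = markedCount n l := by
  induction n using Nat.strong_induction_on generalizing l W with
  | _ n ih =>
    rcases n with _ | n
    · obtain rfl : W.card = l := by omega
      rw [Finset.powersetCard_self, Finset.sum_singleton, Finset.sdiff_self,
        avoidersBelow_empty_left, markedCount_zero_left, Finset.card_singleton]
    have hcard : ∀ Y : Finset ℕ, Y.card < n + 1 →
        (avoidersBelow Y ∅).card = markedCount Y.card 0 := fun Y hY => by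
      simpa using ih Y.card hY 0 Y rfl
    have key : ∀ (l N : ℕ) (W : Finset ℕ), N ∉ W → (∀ y ∈ W, y < N) → W.card = n + l →
        ∑ X ∈ W.powersetCard l, (avoidersBelow (insert N W \ X) X).card =
          ∑ j ∈ Finset.range (n + 1), markedCount j 0 * markedCount (n - j) (j + l) := by
      intro l N W hNW hmax hW
      have hrec : ∀ j ∈ Finset.range (n + 1), markedCount j 0 * markedCount (n - j) (j + l) =
          markedCount j 0 *
            ∑ Z ∈ W.powersetCard (j + l), (avoidersBelow (W \ Z) Z).card := by
        intro j hj
        have := Finset.mem_range.1 hj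
        rw [ih (n - j) (by omega) (j + l) W (by omega)]
      rw [Finset.sum_congr rfl hrec, ← Finset.sum_powersetCard_sum_lt W n l hW
        (fun Z => (avoidersBelow (W \ Z) Z).card) (fun j => markedCount j 0)]
      refine Finset.sum_congr rfl fun X hX => ?_
      obtain ⟨hXW, hXl⟩ := Finset.mem_powersetCard.1 hX
      have hNX : N ∉ X := fun h => hNW (hXW h)
      have herase : (insert N W \ X).erase N = W \ X := by
        ext y
        by_cases hy : y = N <;> simp [hy, hNW]
      rw [card_avoidersBelow (N := N) (by simp [hNX]), herase]
      · refine Finset.sum_congr rfl fun Y hY => ?_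
        have hY' := Finset.mem_powerset.1 (Finset.mem_filter.1 hY).1
        have := Finset.card_le_card hY'
        rw [Finset.card_sdiff_of_subset hXW] at this
        rw [hcard Y (by omega), sdiff_sdiff_left]
        rfl
      · intro y hy
        rcases Finset.mem_insert.1 (Finset.mem_sdiff.1 hy).1 with rfl | hy
        exacts [le_rfl, (hmax y hy).le]
    induction l generalizing W with
    | zero =>
      have hne : W.Nonempty := Finset.card_pos.1 (by omega)
      have hins := Finset.insert_erase (W.max'_mem hne)
      have := key 0 (W.max' hne) (W.erase (W.max' hne)) (by simp)
        (fun y hy => W.lt_max'_of_mem_erase_max' hne hy)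
        (by rw [Finset.card_erase_of_mem (W.max'_mem hne)]; omega)
      rw [hins] at this
      rw [markedCount_succ_zero]
      simpa using this
    | succ l ihl =>
      have hne : W.Nonempty := Finset.card_pos.1 (by omega)
      obtain ⟨N, W, hNW, hmax, rfl⟩ : ∃ N W', N ∉ W' ∧ (∀ y ∈ W', y < N) ∧ W = insert N W' :=
        ⟨W.max' hne, W.erase (W.max' hne), by simp,
          fun y hy => W.lt_max'_of_mem_erase_max' hne hy,
          (Finset.insert_erase (W.max'_mem hne)).symm⟩
      rw [Finset.card_insert_of_notMem hNW] at hW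
      rw [Finset.powersetCard_succ_insert hNW, Finset.sum_union,
        key (l + 1) N W hNW hmax (by omega), Finset.sum_image, markedCount_succ_succ, ← ihl W (by omega), add_comm]
      · congr 1
        refine Finset.sum_congr rfl fun X hX => ?_
        have : insert N W \ insert N X = W \ X := by
          ext y
          by_cases hy : y = N <;> simp [hy, hNW]
        rw [this, avoidersBelow_insert_max fun y hy => hmax y (Finset.mem_sdiff.1 hy).1]
      · intro X hX X' hX' h
        have h1 : N ∉ X := fun h => hNW ((Finset.mem_powersetCard.1 hX).1 h)
        have h2 : N ∉ X' := fun h => hNW ((Finset.mem_powersetCard.1 hX').1 h)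
        rw [← Finset.erase_insert h1, ← Finset.erase_insert h2]
        exact congrArg (fun S => Finset.erase S N) h
      · refine Finset.disjoint_left.2 fun X hX hX' => ?_
        obtain ⟨X', -, rfl⟩ := Finset.mem_image.1 hX'
        exact hNW ((Finset.mem_powersetCard.1 hX).1 (Finset.mem_insert_self _ _))

theorem avoidsBarredWord_ofFn {m : ℕ} (π : Equiv.Perm (Fin m)) :
    AvoidsBarredWord (List.ofFn fun i => (π i : ℕ)) ↔ AvoidsBarred π := by
  have hget : ∀ i : Fin m, (List.ofFn fun i => (π i : ℕ)).getD i 0 = π i := fun i => by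
    rw [List.getD_eq_getElem _ _ (by simp), List.getElem_ofFn]
  constructor
  · intro h i j k l hij hjk hkl h1 h2 h3
    have := h i j k l hij hjk hkl (by simp)
    simp only [hget] at this
    obtain ⟨p, hp1, hp2, hp3⟩ := this h1 h2 h3
    have hp := hget ⟨p, hp2.trans j.2⟩
    simp only at hp
    rw [hp] at hp3
    exact ⟨⟨p, hp2.trans j.2⟩, hp1, hp2, hp3⟩
  · intro h i j k l hij hjk hkl hl h1 h2 h3
    rw [List.length_ofFn] at hl
    lift l to Fin m using hl
    lift k to Fin m using hkl.trans l.2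
    lift j to Fin m using hjk.trans k.2
    lift i to Fin m using hij.trans j.2
    rw [hget, hget] at h1 h2 h3
    obtain ⟨p, hp1, hp2, hp3⟩ := h i j k l hij hjk hkl h1 h2 h3
    exact ⟨p, hp1, hp2, by rw [hget, hget]; exact hp3⟩

theorem card_avoidsBarred (m : ℕ) :
    Nat.card {π : Equiv.Perm (Fin m) // AvoidsBarred π} = markedCount m 0 := by
  have h := sum_card_avoidersBelow m 0 (Finset.range m) (by simp)
  simp only [Finset.powersetCard_zero, Finset.sum_singleton, Finset.sdiff_empty] at h
  rw [← h, ← Nat.card_eq_finsetCard]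
  refine Nat.card_eq_of_bijective
    (fun π => ⟨List.ofFn fun i => (π.1 i : ℕ), mem_avoidersBelow.2 ⟨⟨?_, fun y => ?_⟩,
      (avoidsBarredWord_ofFn π.1).2 π.2, by simp⟩⟩) ⟨?_, ?_⟩
  · exact List.nodup_ofFn.2 (Fin.val_injective.comp π.1.injective)
  · rw [List.mem_ofFn, Finset.mem_range]
    constructor
    · rintro ⟨i, rfl⟩
      exact (π.1 i).2
    · intro hy
      exact ⟨π.1.symm ⟨y, hy⟩, by simp⟩
  · rintro ⟨π, hπ⟩ ⟨ρ, hρ⟩ heq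
    have := List.ofFn_injective (Subtype.mk.inj heq)
    exact Subtype.ext (Equiv.ext fun i => Fin.ext (congrFun this i))
  · rintro ⟨w, hw⟩
    obtain ⟨⟨hnd, hmem⟩, hav, -⟩ := mem_avoidersBelow.1 hw
    have hlen : w.length = m := by
      rw [← List.toFinset_card_of_nodup hnd, ← Finset.card_range m]
      congr 1
      ext y
      rw [List.mem_toFinset, hmem]
    subst hlen
    have hlt : ∀ i : Fin w.length, w[i] < w.length := fun i =>
      Finset.mem_range.1 ((hmem _).1 (List.getElem_mem i.2))
    have hinj : Function.Injective fun i : Fin w.length => (⟨w[i], hlt i⟩ : Fin w.length) := by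
      intro i j hij
      exact List.nodup_iff_injective_get.1 hnd (Fin.mk.inj_iff.1 hij)
    have hw' : List.ofFn (fun i =>
        (Equiv.ofBijective _ (Finite.injective_iff_bijective.1 hinj) i : ℕ)) = w := by
      simp
    refine ⟨⟨Equiv.ofBijective _ (Finite.injective_iff_bijective.1 hinj), ?_⟩, Subtype.ext hw'⟩
    rw [← avoidsBarredWord_ofFn, hw']
    exact hav

open PowerSeries in
theorem PowerSeries.coeff_mul_subst_X_mul {R : Type*} [CommRing R] (B C ψ : R⟦X⟧) (n : ℕ) :
    coeff n (C * ψ.subst (X * B)) =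
      ∑ j ∈ Finset.range (n + 1), coeff j ψ * coeff (n - j) (C * B ^ j) := by
  have hs : HasSubst (X * B : R⟦X⟧) := HasSubst.of_constantCoeff_zero' (by simp)
  have hX : ∀ q m : ℕ, coeff q ((X * B) ^ m) = if m ≤ q then coeff (q - m) (B ^ m) else 0 :=
    fun q m => by rw [mul_pow, coeff_X_pow_mul']
  have htrunc : ∀ q ≤ n, coeff q (ψ.subst (X * B)) =
      coeff q (∑ j ∈ Finset.range (n + 1), coeff j ψ • (X * B) ^ j) := by
    intro q hq
    rw [coeff_subst' hs, finsum_eq_sum_of_support_subset (s := Finset.range (n + 1)), map_sum]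
    · simp only [coeff_smul]
    · intro m hm
      by_contra hn
      refine hm ?_
      simp only [Finset.coe_range, Set.mem_Iio] at hn
      simp only [hX]
      rw [if_neg (by omega), smul_zero]
  have : coeff n (C * ψ.subst (X * B)) =
      coeff n (C * ∑ j ∈ Finset.range (n + 1), coeff j ψ • (X * B) ^ j) := by
    rw [coeff_mul, coeff_mul]
    refine Finset.sum_congr rfl fun p hp => ?_
    rw [htrunc p.2 (Finset.HasAntidiagonal.antidiagonal.snd_le hp)]
  rw [this, Finset.mul_sum, map_sum]
  refine Finset.sum_congr rfl fun j hj => ?_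
  rw [mul_smul_comm, coeff_smul, mul_pow, mul_left_comm, coeff_X_pow_mul',
    if_pos (Nat.lt_succ_iff.1 (Finset.mem_range.1 hj)), smul_eq_mul]

open PowerSeries in
/-- Lagrange inversion: if `B = φ(xB)`, then `(n + k) [xⁿ] Bᵏ = k [uⁿ] φⁿ⁺ᵏ`. -/
theorem PowerSeries.lagrange_inversion {K : Type*} [Field K] [CharZero K] (B φ : K⟦X⟧)
    (h : φ.subst (X * B) = B) (n k : ℕ) :
    (n + k : K) * coeff n (B ^ k) = k * coeff n (φ ^ (n + k)) := by
  have hs : HasSubst (X * B : K⟦X⟧) := HasSubst.of_constantCoeff_zero' (by simp)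
  have hexp : ∀ n k : ℕ, coeff n (B ^ k) =
      ∑ j ∈ Finset.range (n + 1), coeff j (φ ^ k) * coeff (n - j) (B ^ j) := by
    intro n k
    have := coeff_mul_subst_X_mul B 1 (φ ^ k) n
    simpa only [subst_pow hs, h, one_mul] using this
  induction n using Nat.strong_induction_on generalizing k with
  | _ n ih =>
    rcases Nat.eq_zero_or_pos n with rfl | hn
    · rw [hexp]; simp
    rcases Nat.eq_zero_or_pos k with rfl | hk
    · simp [coeff_one, hn.ne']
    have hn' : (n : K) ≠ 0 := by exact_mod_cast hn.ne'
    have hXd : ∀ (f : K⟦X⟧) (m : ℕ), coeff m (X * d⁄dX K f) = m * coeff m f := by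
      intro f m
      rcases m with _ | m
      · simp
      · rw [coeff_succ_X_mul, coeff_derivative]
        push_cast
        ring
    have hstep : (n : K) * coeff n (B ^ k) = coeff n (X * d⁄dX K (φ ^ k) * φ ^ n) := by
      rw [hexp, coeff_mul, Finset.mul_sum, Finset.Nat.sum_antidiagonal_eq_sum_range_succ_mk]
      refine Finset.sum_congr rfl fun j hj => ?_
      have hjn := Nat.lt_succ_iff.1 (Finset.mem_range.1 hj)
      simp only [hXd]
      rcases Nat.eq_zero_or_pos j with rfl | hj'
      · simp [coeff_one, hn.ne']
      · have := ih (n - j) (by omega) j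
        rw [Nat.cast_sub hjn, sub_add_cancel, Nat.sub_add_cancel hjn] at this
        rw [mul_left_comm, this]
        ring
    have hder : ((n + k : ℕ) : K⟦X⟧) * (X * d⁄dX K (φ ^ k) * φ ^ n) =
        (k : K⟦X⟧) * (X * d⁄dX K (φ ^ (n + k))) := by
      obtain ⟨k, rfl⟩ := Nat.exists_eq_add_of_le' hk
      simp only [Derivation.leibniz_pow, smul_eq_mul, nsmul_eq_mul, Nat.add_sub_cancel,
        show n + (k + 1) - 1 = n + k by omega]
      ring
    have hc := congrArg (coeff n) hder
    rw [← map_natCast (C (R := K)), ← map_natCast (C (R := K)), coeff_C_mul, coeff_C_mul, hXd,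
      ← hstep] at hc
    refine mul_left_cancel₀ hn' ?_
    push_cast at hc
    linear_combination hc

open PowerSeries in
/-- The generating function of the 3̄5241-avoiding permutations by length. -/
noncomputable def avoiderSeries : ℚ⟦X⟧ := mk fun n => (markedCount n 0 : ℚ)

open PowerSeries in
theorem coeff_succ_avoiderSeries_of_le {n : ℕ}
    (h : ∀ m ≤ n, ∀ l, coeff m (avoiderSeries ^ (l + 1)) = (markedCount m l : ℚ)) :
    coeff (n + 1) avoiderSeries =
      coeff n (avoiderSeries * avoiderSeries.subst (X * avoiderSeries)) := by
  rw [coeff_mul_subst_X_mul]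
  rw [avoiderSeries, coeff_mk, markedCount_succ_zero, ← avoiderSeries]
  push_cast
  refine Finset.sum_congr rfl fun j _ => ?_
  rw [← pow_succ', h (n - j) (by omega), avoiderSeries, coeff_mk]

open PowerSeries in
theorem coeff_avoiderSeries_pow (n l : ℕ) :
    coeff n (avoiderSeries ^ (l + 1)) = (markedCount n l : ℚ) := by
  induction n using Nat.strong_induction_on generalizing l with
  | _ n ih =>
    rcases n with _ | n
    · simp [avoiderSeries, markedCount_zero_left]
    induction l with
    | zero => simp [avoiderSeries]
    | succ l ihl =>
      have hB : ∀ q ≤ n + 1, coeff q (avoiderSeries - 1) =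
          coeff q (X * (avoiderSeries * avoiderSeries.subst (X * avoiderSeries))) := by
        intro q hq
        rcases q with _ | q
        · simp [avoiderSeries, markedCount_zero_left]
        · rw [coeff_succ_X_mul, ← coeff_succ_avoiderSeries_of_le fun m hm => ih m (by omega)]
          simp [coeff_one]
      have hmul : coeff (n + 1) (avoiderSeries ^ (l + 1) * (avoiderSeries - 1)) =
          coeff (n + 1) (avoiderSeries ^ (l + 1) *
            (X * (avoiderSeries * avoiderSeries.subst (X * avoiderSeries)))) := by
        rw [coeff_mul, coeff_mul]
        refine Finset.sum_congr rfl fun p hp => ?_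
        rw [hB p.2 (Finset.HasAntidiagonal.antidiagonal.snd_le hp)]
      rw [show avoiderSeries ^ (l + 1 + 1) =
        avoiderSeries ^ (l + 1) + avoiderSeries ^ (l + 1) * (avoiderSeries - 1) by ring, map_add,
        ihl, hmul, mul_left_comm, coeff_succ_X_mul, ← mul_assoc, coeff_mul_subst_X_mul,
        markedCount_succ_succ]
      push_cast
      congr 1
      refine Finset.sum_congr rfl fun j _ => ?_
      rw [← pow_succ, ← pow_add, show l + 1 + 1 + j = j + (l + 1) + 1 by omega,
        ih (n - j) (by omega), avoiderSeries, coeff_mk]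

open PowerSeries in
theorem subst_one_add_X_mul_avoiderSeries :
    (1 + X * avoiderSeries).subst (X * avoiderSeries) = avoiderSeries := by
  have hs : HasSubst (X * avoiderSeries) := HasSubst.of_constantCoeff_zero' (by simp)
  have h1 : (1 : ℚ⟦X⟧).subst (X * avoiderSeries) = 1 := by
    rw [← coe_substAlgHom hs, map_one]
  rw [subst_add hs, subst_mul hs, subst_X hs, h1]
  ext n
  rcases n with _ | n
  · simp [avoiderSeries, markedCount_zero_left]
  · rw [coeff_succ_avoiderSeries_of_le fun m _ => coeff_avoiderSeries_pow m, map_add, mul_assoc,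
      coeff_succ_X_mul, coeff_one, if_neg (by omega), zero_add]

open PowerSeries in
theorem pSum_eq_coeff (n : ℕ) (a : ℕ → ℚ) :
    pSum n a = coeff n ((1 + X * mk fun i => a (i + 1)) ^ (n + 1)) := by
  let f : Option (Fin n) → ℚ⟦X⟧ := fun o => o.elim 1 fun i => C (a (i + 1)) * X ^ ((i : ℕ) + 1)
  have hf : X ^ (n + 1) ∣ (1 + X * mk fun i => a (i + 1)) - ∑ o, f o := by
    refine X_pow_dvd_iff.2 fun m hm => ?_
    rw [Fintype.sum_option, map_sub, map_add, map_add, map_sum]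
    simp only [f, Option.elim_none, Option.elim_some, coeff_C_mul, coeff_X_pow]
    rcases m with _ | m
    · simp
    · rw [Finset.sum_eq_single (⟨m, by omega⟩ : Fin n)]
      · simp [coeff_succ_X_mul]
      · intro b _ hb
        rw [if_neg fun h => hb (Fin.ext (by simp at h ⊢; omega)), mul_zero]
      · simp
  have hpow := X_pow_dvd_iff.1 (hf.trans (sub_dvd_pow_sub_pow _ _ (n + 1))) n (by omega)
  rw [map_sub, sub_eq_zero] at hpow
  rw [hpow, Finset.sum_pow_eq_sum_piAntidiag, map_sum]
  have hterm : ∀ k : Option (Fin n) → ℕ,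
      coeff n ((Nat.multinomial Finset.univ k : ℚ⟦X⟧) * ∏ o, f o ^ k o) =
        if ∑ i : Fin n, ((i : ℕ) + 1) * k (some i) = n then
          (Nat.multinomial Finset.univ k : ℚ) * ∏ i : Fin n, a (i + 1) ^ k (some i) else 0 := by
    intro k
    rw [Fintype.prod_option]
    simp only [f, Option.elim_none, Option.elim_some, one_pow, one_mul, mul_pow,
      Finset.prod_mul_distrib, ← pow_mul, Finset.prod_pow_eq_pow_sum, ← map_pow, ← map_prod]
    rw [← map_natCast (C (R := ℚ)), coeff_C_mul, coeff_C_mul, coeff_X_pow]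
    by_cases h : ∑ i : Fin n, ((i : ℕ) + 1) * k (some i) = n
    · rw [if_pos h, if_pos h.symm, mul_one]
    · rw [if_neg h, if_neg (Ne.symm h), mul_zero, mul_zero]
  rw [Finset.sum_congr rfl fun k _ => hterm k, ← Finset.sum_filter, pSum]
  have hle : ∀ r : Fin n → ℕ, ∑ i : Fin n, ((i : ℕ) + 1) * r i = n → ∑ i, r i ≤ n := by
    intro r h
    conv_rhs => rw [← h]
    exact Finset.sum_le_sum fun i _ => Nat.le_mul_of_pos_left _ (Nat.succ_pos _)
  refine Finset.sum_bij
    (fun r _ o => Option.elim o (n + 1 - ∑ i, (r i).1) fun i => (r i).1) ?_ ?_ ?_ ?_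
  · intro r hr
    have hr' := (Finset.mem_filter.1 hr).2
    have := hle _ hr'
    simp only [Finset.mem_filter, Finset.mem_piAntidiag, Fintype.sum_option, Option.elim_none,
      Option.elim_some, Finset.mem_univ, implies_true, and_true]
    exact ⟨by omega, hr'⟩
  · intro r _ r' _ h
    exact funext fun i => Fin.ext (congrFun h (some i))
  · intro k hk
    simp only [Finset.mem_filter, Finset.mem_piAntidiag, Fintype.sum_option, Finset.mem_univ,
      implies_true, and_true] at hk
    have hsum := hle _ hk.2
    refine ⟨fun i => ⟨k (some i), ?_⟩, by simpa using hk.2, ?_⟩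
    · have := Finset.single_le_sum (f := fun i => k (some i)) (fun _ _ => Nat.zero_le _)
        (Finset.mem_univ i)
      omega
    · funext o
      cases o with
      | none => simp only [Option.elim_none]; omega
      | some i => rfl
  · intro r hr
    have := hle _ (Finset.mem_filter.1 hr).2
    simp only [Option.elim_some]
    congr 1
    have hspec := Nat.multinomial_spec Finset.univ
      (fun o : Option (Fin n) => Option.elim o (n + 1 - ∑ i, (r i).1) fun i => (r i).1)
    rw [Fintype.sum_option, Fintype.prod_option] at hspec
    simp only [Option.elim_none, Option.elim_some] at hspec
    rw [Nat.sub_add_cancel (by omega)] at hspec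
    rw [← hspec]
    push_cast
    refine mul_div_cancel_left₀ _ (mul_ne_zero ?_ (Finset.prod_ne_zero_iff.2 fun i _ => ?_)) <;>
      exact_mod_cast Nat.factorial_ne_zero _

/-- With `aₙ` the number of 3̄5241-avoiding permutations of `[n-1]`
(`a₁ = 1` counting the empty permutation), for all `n ≥ 1`,
`a_{n+1} = (1/(n+1)) ∑ multinomial(n+1; n+1-∑rᵢ, r₁,…,rₙ) a₁^{r₁}⋯aₙ^{rₙ}`,
summed over partitions `1^{r₁}⋯n^{rₙ} ⊢ n`. -/
theorem avoiders_satisfy_recurrence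
    (a : ℕ → ℚ)
    (ha : ∀ n, a n = Nat.card {π : Equiv.Perm (Fin (n - 1)) // AvoidsBarred π}) :
    ∀ n : ℕ, 1 ≤ n → a (n + 1) = (1 / (n + 1 : ℚ)) * pSum n a := by
  intro n _
  have hmark : ∀ m, a (m + 1) = markedCount m 0 := fun m => by
    rw [ha, Nat.add_sub_cancel, card_avoidsBarred]
  have hlag := PowerSeries.lagrange_inversion _ _ subst_one_add_X_mul_avoiderSeries n 1
  have hcoeff := coeff_avoiderSeries_pow n 0
  rw [zero_add] at hcoeff
  rw [hcoeff, Nat.cast_one, one_mul] at hlag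
  rw [pSum_eq_coeff, hmark, funext hmark, ← avoiderSeries, ← hlag]
  field_simp
end
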